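/- arXiv:1103.3525 — 7 statements merged into one kernel-verified Lean document; each statement's English description precedes it below -/
import Mathlib

section
/- Let X and Y be Banach spaces, U an open subset of X, and F : X → Y a map that is continuously (Fréchet) differentiable on U. Let x₀ ∈ U and suppose the derivative D := dF(x₀) : X → Y is surjective and admits a bounded linear right inverse Q : Y → X (so D ∘ Q = id_Y) with operator norm ‖Q‖ ≤ C. Suppose h > 0 is such that the open ball B_h(x₀) is contained in U and for every x ∈ B_h(x₀) one has ‖dF(x) − D‖ ≤ 1/(2C), and suppose ‖F(x₀)‖ ≤ h/(4C). Then there exists a unique x ∈ B_h(x₀) such that F(x) = 0 and x − x₀ lies in the range of Q; moreover this x satisfies ‖x − x₀‖ ≤ 2C‖F(x₀)‖. -/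
/-- Abstract implicit function theorem (Proposition `prop:abstractglue`):
given a continuously differentiable map `F` between Banach spaces whose derivative
at `x₀` has a bounded right inverse `Q` with `‖Q‖ ≤ C`, whose derivative varies by at
most `1/(2C)` on the ball `B_h(x₀) ⊆ U`, and with `‖F x₀‖ ≤ h/(4C)`, there is a unique
zero `x` of `F` in `B_h(x₀)` with `x - x₀ ∈ range Q`, and it satisfies
`‖x - x₀‖ ≤ 2C‖F x₀‖`. -/
theorem abstract_implicit_function_theorem
    {X Y : Type*} [NormedAddCommGroup X] [NormedSpace ℝ X] [CompleteSpace X]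
    [NormedAddCommGroup Y] [NormedSpace ℝ Y] [CompleteSpace Y]
    (U : Set X) (hU : IsOpen U)
    (F : X → Y) (F' : X → X →L[ℝ] Y)
    (hF : ∀ x ∈ U, HasFDerivAt F (F' x) x) (hF' : ContinuousOn F' U)
    (x₀ : X) (hx₀ : x₀ ∈ U)
    (hsurj : Function.Surjective (F' x₀))
    (Q : Y →L[ℝ] X)
    (hQright : (F' x₀).comp Q = ContinuousLinearMap.id ℝ Y)
    (C : ℝ) (hC : 0 < C) (hQnorm : ‖Q‖ ≤ C)
    (h : ℝ) (hh : 0 < h) (hball : Metric.ball x₀ h ⊆ U)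
    (hvar : ∀ x ∈ Metric.ball x₀ h, ‖F' x - F' x₀‖ ≤ 1 / (2 * C))
    (hF0 : ‖F x₀‖ ≤ h / (4 * C)) :
    ∃ x : X,
      (x ∈ Metric.ball x₀ h ∧ F x = 0 ∧ x - x₀ ∈ Set.range Q ∧
        ‖x - x₀‖ ≤ 2 * C * ‖F x₀‖) ∧
      ∀ y : X, y ∈ Metric.ball x₀ h → F y = 0 → y - x₀ ∈ Set.range Q → y = x := by
  have approx : ∀ a b : Y, x₀ + Q a ∈ Metric.ball x₀ h → x₀ + Q b ∈ Metric.ball x₀ h →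
      ‖F (x₀ + Q a) - F (x₀ + Q b) - (a - b)‖ ≤ 1 / 2 * ‖a - b‖ := by
    intro a b ha hb
    have hDQ : F' x₀ (Q (a - b)) = a - b := DFunLike.congr_fun hQright (a - b)
    have mean_value := (convex_ball x₀ h).norm_image_sub_le_of_norm_hasFDerivWithin_le'
      (fun x hx => (hF x (hball hx)).hasFDerivWithinAt) hvar hb ha
    rw [add_sub_add_left_eq_sub, ← map_sub, hDQ] at mean_value
    calc ‖F (x₀ + Q a) - F (x₀ + Q b) - (a - b)‖
        ≤ 1 / (2 * C) * ‖Q (a - b)‖ := mean_value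
      _ ≤ 1 / (2 * C) * (C * ‖a - b‖) := by
          gcongr
          exact Q.le_of_opNorm_le hQnorm _
      _ = 1 / 2 * ‖a - b‖ := by field_simp
  have norm_Q_le : ∀ a ∈ Metric.closedBall (0 : Y) (2 * ‖F x₀‖),
      ‖Q a‖ ≤ 2 * C * ‖F x₀‖ := by
    intro a ha
    rw [mem_closedBall_zero_iff] at ha
    calc ‖Q a‖ ≤ C * ‖a‖ := Q.le_of_opNorm_le hQnorm a
      _ ≤ C * (2 * ‖F x₀‖) := by gcongr
      _ = 2 * C * ‖F x₀‖ := by ring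
  have mem_ball : ∀ a ∈ Metric.closedBall (0 : Y) (2 * ‖F x₀‖),
      x₀ + Q a ∈ Metric.ball x₀ h := by
    intro a ha
    rw [le_div_iff₀ (by positivity)] at hF0
    rw [mem_ball_iff_norm, add_sub_cancel_left]
    linarith [norm_Q_le a ha]
  have approximates : ApproximatesLinearOn (fun a => F (x₀ + Q a))
      (ContinuousLinearMap.id ℝ Y) (Metric.closedBall 0 (2 * ‖F x₀‖)) (1 / 2) := by
    intro a ha b hb
    simpa using approx a b (mem_ball a ha) (mem_ball b hb)
  let idInverse : (ContinuousLinearMap.id ℝ Y).NonlinearRightInverse :=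
    { toFun := id
      nnnorm := 1
      bound' := by simp
      right_inv' := by simp }
  have surjOn := approximates.surjOn_closedBall_of_nonlinearRightInverse idInverse
    (by positivity) subset_rfl
  have zero_mem : (0 : Y) ∈ Metric.closedBall (F (x₀ + Q 0))
      (((idInverse.nnnorm : ℝ)⁻¹ - (1 / 2 : NNReal)) * (2 * ‖F x₀‖)) := by
    simp only [map_zero, add_zero, mem_closedBall_iff_norm, zero_sub, norm_neg]
    norm_num [idInverse]
    linarith
  obtain ⟨a, ha, hFa⟩ := surjOn zero_mem
  replace hFa : F (x₀ + Q a) = 0 := hFa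
  refine ⟨x₀ + Q a, ⟨mem_ball a ha, hFa, ⟨a, by simp⟩, by simpa using norm_Q_le a ha⟩, ?_⟩
  rintro y hy hFy ⟨b, hb⟩
  obtain rfl : y = x₀ + Q b := by rw [hb, add_sub_cancel]
  have hab := approx b a hy (mem_ball a ha)
  rw [hFy, hFa, sub_zero, zero_sub, norm_neg] at hab
  have : b - a = 0 := norm_le_zero_iff.1 (by linarith)
  rw [sub_eq_zero.1 this]
end

section
/- Let N ≥ 1 and let x₀, x₁, …, x_N be nonnegative real numbers. Fix a constant γ ∈ (0, 1/2) and suppose x_k ≤ γ·(x_{k−1} + x_{k+1}) for all 1 ≤ k ≤ N−1. Then for all 1 ≤ k ≤ N−1 one has x_k ≤ x₀·ξ^{−k} + x_N·ξ^{−(N−k)}, where ξ = (1 + √(1 − 4γ²))/(2γ). -/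
/-- Discrete maximum principle: a sequence satisfying `d k ≤ γ (d (k - 1) + d (k + 1))` in the
interior of `{0, …, N}`, with `0 ≤ γ < 1 / 2`, is nonpositive if it is nonpositive at both ends. -/
theorem nonpos_of_le_mul_add_neighbors {N : ℕ} {d : ℕ → ℝ} {γ : ℝ} (hγ0 : 0 ≤ γ)
    (hγ : γ < 1 / 2) (h0 : d 0 ≤ 0) (hN : d N ≤ 0)
    (hrec : ∀ k, 1 ≤ k → k ≤ N - 1 → d k ≤ γ * (d (k - 1) + d (k + 1))) :
    ∀ k ≤ N, d k ≤ 0 := by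
  obtain ⟨m, hm, hmax⟩ := Finset.exists_max_image (Finset.range (N + 1)) d ⟨0, by simp⟩
  simp only [Finset.mem_range, Nat.lt_succ_iff] at hm hmax
  suffices d m ≤ 0 from fun k hk => (hmax k hk).trans this
  by_contra! hpos
  have hm0 : m ≠ 0 := by rintro rfl; linarith
  have hmN : m ≠ N := by rintro rfl; linarith
  have hle : d m ≤ γ * (d m + d m) :=
    (hrec m (by lia) (by lia)).trans <| mul_le_mul_of_nonneg_left
      (add_le_add (hmax (m - 1) (by lia)) (hmax (m + 1) (by lia))) hγ0
  nlinarith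

/-- The inverse of `(1 + √(1 - 4γ²)) / (2γ)` is a root of `γ (1 + r²) = r`. -/
theorem mul_one_add_inv_sq_eq_inv {γ : ℝ} (hγ0 : 0 < γ) (hγ : γ < 1 / 2) :
    γ * (1 + ((1 + Real.sqrt (1 - 4 * γ ^ 2)) / (2 * γ))⁻¹ ^ 2) =
      ((1 + Real.sqrt (1 - 4 * γ ^ 2)) / (2 * γ))⁻¹ := by
  have hsq : Real.sqrt (1 - 4 * γ ^ 2) ^ 2 = 1 - 4 * γ ^ 2 := Real.sq_sqrt (by nlinarith)
  have hs := Real.sqrt_nonneg (1 - 4 * γ ^ 2)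
  generalize Real.sqrt (1 - 4 * γ ^ 2) = s at hsq hs ⊢
  have hne : 1 + s ≠ 0 := by positivity
  rw [inv_div]
  field_simp
  linear_combination hsq

/-- Discrete three-interval lemma (Lemma 9.4 of Mundet–Tian, as used in the paper):
if nonnegative numbers `x₀, …, x_N` satisfy `x_k ≤ γ (x_{k-1} + x_{k+1})` for
`1 ≤ k ≤ N - 1` with `γ ∈ (0, 1/2)`, then `x_k ≤ x₀ ξ^{-k} + x_N ξ^{-(N-k)}` where
`ξ = (1 + √(1 - 4γ²))/(2γ)`. -/
theorem three_interval_discrete_decay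
    (N : ℕ) (hN : 1 ≤ N) (x : ℕ → ℝ) (hx : ∀ k, k ≤ N → 0 ≤ x k)
    (γ : ℝ) (hγ0 : 0 < γ) (hγ : γ < 1 / 2)
    (hrec : ∀ k : ℕ, 1 ≤ k → k ≤ N - 1 → x k ≤ γ * (x (k - 1) + x (k + 1))) :
    ∀ k : ℕ, 1 ≤ k → k ≤ N - 1 →
      x k ≤ x 0 * ((1 + Real.sqrt (1 - 4 * γ ^ 2)) / (2 * γ))⁻¹ ^ k
            + x N * ((1 + Real.sqrt (1 - 4 * γ ^ 2)) / (2 * γ))⁻¹ ^ (N - k) := by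
  intro k hk1 hkN
  have hroot := mul_one_add_inv_sq_eq_inv hγ0 hγ
  have hr : 0 ≤ ((1 + Real.sqrt (1 - 4 * γ ^ 2)) / (2 * γ))⁻¹ := by positivity
  generalize ((1 + Real.sqrt (1 - 4 * γ ^ 2)) / (2 * γ))⁻¹ = r at hroot hr ⊢
  have hx0 := hx 0 (Nat.zero_le N)
  have hxN := hx N le_rfl
  refine sub_nonpos.mp <| nonpos_of_le_mul_add_neighbors (N := N)
    (d := fun j => x j - (x 0 * r ^ j + x N * r ^ (N - j))) hγ0.le hγ ?_ ?_ ?_ k (by lia)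
  · have : 0 ≤ x N * r ^ N := by positivity
    simpa using this
  · have : 0 ≤ x 0 * r ^ N := by positivity
    simpa using this
  · intro j hj1 hjN
    have hj := hrec j hj1 hjN
    obtain ⟨i, rfl⟩ := Nat.exists_eq_add_of_le' hj1
    obtain ⟨l, rfl⟩ := Nat.exists_eq_add_of_le' (show i + 2 ≤ N by lia)
    have e1 : l + (i + 2) - (i + 1) = l + 1 := by lia
    have e2 : l + (i + 2) - i = l + 2 := by lia
    have e3 : l + (i + 2) - (i + 1 + 1) = l := by lia
    simp only [Nat.add_sub_cancel, e1, e2, e3] at hj ⊢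
    linear_combination hj + (x 0 * r ^ i + x (l + (i + 2)) * r ^ l) * hroot
end

section
/- Let E be a finite-dimensional real inner product space, let l > 0, let k be a nonzero integer, and let 0 < δ < 1. Let A : ℝ → (E →L E) be a continuous family of continuous linear endomorphisms of E with operator norm ‖A(τ)‖ ≤ δ for all τ ∈ [−l, l]. Suppose a : ℝ → E is continuously differentiable and b : ℝ → E is continuous, and they satisfy the equation a′(τ) + A(τ)(a(τ)) − 2πk·a(τ) = b(τ) for all τ ∈ [−l, l]. Assume the one-point boundary condition: a(l) = 0 if k > 0, and a(−l) = 0 if k < 0. Then ∫_{−l}^{l} ‖a(τ)‖² dτ ≤ (2/((2πk)² − 2δ²))·∫_{−l}^{l} ‖b(τ)‖² dτ, and in particular ∫_{−l}^{l} ‖a(τ)‖² dτ ≤ ∫_{−l}^{l} ‖b(τ)‖² dτ. -/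
/-- `L²` estimate for the Fourier-mode ODE `a' + A(τ)a - 2πk a = b` on `[-l, l]` with the
one-point boundary condition (`a(l) = 0` for `k > 0`, `a(-l) = 0` for `k < 0`) and
`‖A(τ)‖ ≤ δ < 1`:
`∫ ‖a‖² ≤ (2/((2πk)² - 2δ²)) ∫ ‖b‖²` and in particular `∫ ‖a‖² ≤ ∫ ‖b‖²`. -/
theorem L2_estimate_higher_modes
    {E : Type*} [NormedAddCommGroup E] [InnerProductSpace ℝ E] [FiniteDimensional ℝ E]
    (l : ℝ) (hl : 0 < l) (k : ℤ) (hk : k ≠ 0) (δ : ℝ) (hδ0 : 0 < δ) (hδ1 : δ < 1)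
    (A : ℝ → E →L[ℝ] E) (hA : Continuous A)
    (hAbound : ∀ τ ∈ Set.Icc (-l) l, ‖A τ‖ ≤ δ)
    (a a' : ℝ → E) (ha : ∀ τ, HasDerivAt a (a' τ) τ) (ha' : Continuous a')
    (b : ℝ → E) (hb : Continuous b)
    (heq : ∀ τ ∈ Set.Icc (-l) l,
      a' τ + A τ (a τ) - (2 * Real.pi * (k : ℝ)) • a τ = b τ)
    (hbcpos : 0 < k → a l = 0) (hbcneg : k < 0 → a (-l) = 0) :
    (∫ τ in (-l)..l, ‖a τ‖ ^ 2)
        ≤ (2 / ((2 * Real.pi * (k : ℝ)) ^ 2 - 2 * δ ^ 2)) * ∫ τ in (-l)..l, ‖b τ‖ ^ 2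
    ∧ (∫ τ in (-l)..l, ‖a τ‖ ^ 2) ≤ ∫ τ in (-l)..l, ‖b τ‖ ^ 2 := by
  set c : ℝ := 2 * Real.pi * (k : ℝ) with hc
  have hac : Continuous a := continuous_iff_continuousAt.2 fun τ => (ha τ).continuousAt
  have hle : -l ≤ l := by linarith
  have hderiv_int : (∫ τ in (-l)..l, 2 * inner ℝ (a τ) (a' τ)) = ‖a l‖ ^ 2 - ‖a (-l)‖ ^ 2 :=
    intervalIntegral.integral_eq_sub_of_hasDerivAt (f := fun τ => ‖a τ‖ ^ 2)
      (fun τ _ => (ha τ).norm_sq)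
      (Continuous.intervalIntegrable (by fun_prop) _ _)
  have hboundary : c * (‖a l‖ ^ 2 - ‖a (-l)‖ ^ 2) ≤ 0 := by
    rcases lt_or_gt_of_ne hk with h | h
    · have hcneg : c ≤ 0 :=
        mul_nonpos_of_nonneg_of_nonpos (by positivity) (by exact_mod_cast h.le)
      have h0 : ‖a (-l)‖ = 0 := by rw [hbcneg h, norm_zero]
      rw [h0]
      nlinarith [sq_nonneg ‖a l‖]
    · have hcpos : 0 ≤ c := mul_nonneg (by positivity) (by exact_mod_cast h.le)
      have h0 : ‖a l‖ = 0 := by rw [hbcpos h, norm_zero]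
      rw [h0]
      nlinarith [sq_nonneg ‖a (-l)‖]
  have hpointwise : ∀ τ ∈ Set.Icc (-l) l,
      (c ^ 2 - 2 * δ ^ 2) * ‖a τ‖ ^ 2 - c * (2 * inner ℝ (a τ) (a' τ)) ≤ 2 * ‖b τ‖ ^ 2 := by
    intro τ hτ
    have hexpand : ‖a' τ - c • a τ‖ ^ 2
        = ‖a' τ‖ ^ 2 - c * (2 * inner ℝ (a τ) (a' τ)) + c ^ 2 * ‖a τ‖ ^ 2 := by
      rw [norm_sub_sq_real, real_inner_smul_right, norm_smul, mul_pow, Real.norm_eq_abs,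
        sq_abs, real_inner_comm]
      ring
    have hsub : a' τ - c • a τ = b τ - A τ (a τ) := by
      rw [← heq τ hτ]
      abel
    have htri : ‖a' τ - c • a τ‖ ≤ ‖b τ‖ + δ * ‖a τ‖ := by
      rw [hsub]
      exact (norm_sub_le _ _).trans (by gcongr; exact (A τ).le_of_opNorm_le (hAbound τ hτ) _)
    have hsq : ‖a' τ - c • a τ‖ ^ 2 ≤ (‖b τ‖ + δ * ‖a τ‖) ^ 2 := by gcongr
    nlinarith [sq_nonneg (‖b τ‖ - δ * ‖a τ‖), sq_nonneg ‖a' τ‖]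
  have hint : (c ^ 2 - 2 * δ ^ 2) * (∫ τ in (-l)..l, ‖a τ‖ ^ 2)
      ≤ 2 * ∫ τ in (-l)..l, ‖b τ‖ ^ 2 := by
    have h := intervalIntegral.integral_mono_on hle
      (Continuous.intervalIntegrable (μ := MeasureTheory.volume) (by fun_prop) _ _)
      (Continuous.intervalIntegrable (by fun_prop) _ _) hpointwise
    rw [intervalIntegral.integral_sub (Continuous.intervalIntegrable (by fun_prop) _ _)
      (Continuous.intervalIntegrable (by fun_prop) _ _)] at h
    simp only [intervalIntegral.integral_const_mul] at h hderiv_int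
    rw [hderiv_int] at h
    linarith
  have hgap : 2 < c ^ 2 - 2 * δ ^ 2 := by
    have hk1 : (1 : ℝ) ≤ (k : ℝ) ^ 2 := by
      exact_mod_cast Int.add_one_le_iff.2 (pow_pos (abs_pos.2 hk) 2 |>.trans_eq (sq_abs k))
    have hpi : 9 < Real.pi ^ 2 := by nlinarith [Real.pi_gt_three]
    have hc2 : c ^ 2 = 4 * Real.pi ^ 2 * (k : ℝ) ^ 2 := by rw [hc]; ring
    nlinarith
  have hb_nonneg : 0 ≤ ∫ τ in (-l)..l, ‖b τ‖ ^ 2 :=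
    intervalIntegral.integral_nonneg hle fun τ _ => by positivity
  have hmain : (∫ τ in (-l)..l, ‖a τ‖ ^ 2)
      ≤ 2 / (c ^ 2 - 2 * δ ^ 2) * ∫ τ in (-l)..l, ‖b τ‖ ^ 2 := by
    rw [div_mul_eq_mul_div, le_div_iff₀ (by linarith)]
    linarith
  refine ⟨hmain, hmain.trans (mul_le_of_le_one_left hb_nonneg ?_)⟩
  rw [div_le_one (by linarith)]
  exact hgap.le
end

section
/- Let E be a finite-dimensional real inner product space, let l > 0, let k be a nonzero integer, and let 0 < δ < 1. Let A : ℝ → (E →L E) be a continuous family of continuous linear endomorphisms of E with operator norm ‖A(τ)‖ ≤ δ for all τ ∈ [−l, l]. Suppose a : ℝ → E is continuously differentiable and b : ℝ → E is continuous, and they satisfy the equation a′(τ) + A(τ)(a(τ)) − 2πk·a(τ) = b(τ) for all τ ∈ [−l, l]. If k > 0 and a(l) = 0, then ‖a(−l)‖² ≤ (1/(kπ))·∫_{−l}^{l} ‖b(τ)‖² dτ; if k < 0 and a(−l) = 0, then ‖a(l)‖² ≤ (1/(|k|π))·∫_{−l}^{l} ‖b(τ)‖² dτ. -/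
/-- A vector field with a dissipative term `-2 c x`, a perturbation `T` of norm at most `1 ≤ c`, and
a forcing `w` increases `‖x‖²` at a rate of at most `‖w‖² / c`. -/
lemma two_mul_inner_le_of_dissipative
    {E : Type*} [NormedAddCommGroup E] [InnerProductSpace ℝ E]
    {c : ℝ} (hc : 1 ≤ c) {T : E →L[ℝ] E} (hT : ‖T‖ ≤ 1) (x w : E) :
    2 * inner ℝ x (w - T x - (2 * c) • x) ≤ 1 / c * ‖w‖ ^ 2 := by
  have hc0 : 0 < c := by linarith
  have hTx : -inner ℝ x (T x) ≤ ‖x‖ ^ 2 := by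
    have h₁ : |inner ℝ x (T x)| ≤ ‖x‖ * ‖T x‖ := abs_real_inner_le_norm x (T x)
    have h₂ : ‖T x‖ ≤ ‖x‖ := by simpa using T.le_of_opNorm_le hT x
    nlinarith [neg_abs_le (inner ℝ x (T x)), norm_nonneg x]
  have hw : 2 * inner ℝ x w ≤ c * ‖x‖ ^ 2 + 1 / c * ‖w‖ ^ 2 := by
    have h₁ : inner ℝ x w ≤ ‖x‖ * ‖w‖ := real_inner_le_norm x w
    have h₂ : c * ‖x‖ ^ 2 + 1 / c * ‖w‖ ^ 2 - 2 * (‖x‖ * ‖w‖) =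
        1 / c * (c * ‖x‖ - ‖w‖) ^ 2 := by
      field_simp
      ring
    have h₃ : 0 ≤ 1 / c * (c * ‖x‖ - ‖w‖) ^ 2 := by positivity
    linarith
  rw [inner_sub_right, inner_sub_right, inner_smul_right, real_inner_self_eq_norm_sq]
  nlinarith [sq_nonneg ‖x‖]

lemma norm_sq_sub_norm_sq_eq_integral
    {E : Type*} [NormedAddCommGroup E] [InnerProductSpace ℝ E]
    {a a' : ℝ → E} (ha : ∀ τ, HasDerivAt a (a' τ) τ) (ha' : Continuous a') (s t : ℝ) :
    ‖a t‖ ^ 2 - ‖a s‖ ^ 2 = ∫ τ in s..t, 2 * inner ℝ (a τ) (a' τ) := by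
  have hac : Continuous a := continuous_iff_continuousAt.2 fun τ => (ha τ).continuousAt
  exact (intervalIntegral.integral_eq_sub_of_hasDerivAt (fun τ _ => (ha τ).norm_sq)
    ((continuous_const.mul (hac.inner ha')).intervalIntegrable s t)).symm

/-- Boundary-value estimate for the Fourier-mode ODE `a' + A(τ)a - 2πk a = b` on `[-l, l]`
with `‖A(τ)‖ ≤ δ < 1`: if `k > 0` and `a(l) = 0` then
`‖a(-l)‖² ≤ (1/(kπ)) ∫ ‖b‖²`, and if `k < 0` and `a(-l) = 0` then
`‖a(l)‖² ≤ (1/(|k|π)) ∫ ‖b‖²`. -/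
theorem boundary_value_estimate_higher_modes
    {E : Type*} [NormedAddCommGroup E] [InnerProductSpace ℝ E] [FiniteDimensional ℝ E]
    (l : ℝ) (hl : 0 < l) (k : ℤ) (hk : k ≠ 0) (δ : ℝ) (hδ0 : 0 < δ) (hδ1 : δ < 1)
    (A : ℝ → E →L[ℝ] E) (hA : Continuous A)
    (hAbound : ∀ τ ∈ Set.Icc (-l) l, ‖A τ‖ ≤ δ)
    (a a' : ℝ → E) (ha : ∀ τ, HasDerivAt a (a' τ) τ) (ha' : Continuous a')
    (b : ℝ → E) (hb : Continuous b)
    (heq : ∀ τ ∈ Set.Icc (-l) l,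
      a' τ + A τ (a τ) - (2 * Real.pi * (k : ℝ)) • a τ = b τ) :
    (0 < k → a l = 0 →
        ‖a (-l)‖ ^ 2 ≤ (1 / ((k : ℝ) * Real.pi)) * ∫ τ in (-l)..l, ‖b τ‖ ^ 2)
    ∧ (k < 0 → a (-l) = 0 →
        ‖a l‖ ^ 2 ≤ (1 / (|(k : ℝ)| * Real.pi)) * ∫ τ in (-l)..l, ‖b τ‖ ^ 2) := by
  have hac : Continuous a := continuous_iff_continuousAt.2 fun τ => (ha τ).continuousAt
  have hll : -l ≤ l := by linarith
  have h_int := norm_sq_sub_norm_sq_eq_integral ha ha' (-l) l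
  have h_cont : Continuous fun τ => 2 * inner ℝ (a τ) (a' τ) :=
    continuous_const.mul (hac.inner ha')
  have hA1 : ∀ τ ∈ Set.Icc (-l) l, ‖A τ‖ ≤ 1 := fun τ hτ => (hAbound τ hτ).trans hδ1.le
  have hc : 1 ≤ |(k : ℝ)| * Real.pi := by
    have : (1 : ℝ) ≤ |(k : ℝ)| := by exact_mod_cast Int.one_le_abs hk
    nlinarith [Real.pi_gt_three]
  have hbc : Continuous fun τ => 1 / (|(k : ℝ)| * Real.pi) * ‖b τ‖ ^ 2 :=
    continuous_const.mul (hb.norm.pow 2)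
  have ha'_eq : ∀ τ ∈ Set.Icc (-l) l, a' τ = b τ - A τ (a τ) + (2 * Real.pi * (k : ℝ)) • a τ := by
    intro τ hτ
    rw [← heq τ hτ]
    abel
  rw [← intervalIntegral.integral_const_mul, ← intervalIntegral.integral_const_mul]
  constructor
  · intro hpos h0
    have hkabs : |(k : ℝ)| = k := abs_of_pos (by exact_mod_cast hpos)
    rw [hkabs] at hc hbc
    have h_le : ∀ τ ∈ Set.Icc (-l) l,
        -(2 * inner ℝ (a τ) (a' τ)) ≤ 1 / ((k : ℝ) * Real.pi) * ‖b τ‖ ^ 2 := by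
      intro τ hτ
      have h := two_mul_inner_le_of_dissipative hc (T := -A τ)
        (by simpa using hA1 τ hτ) (a τ) (-b τ)
      have h_eq : -b τ - (-A τ) (a τ) - (2 * ((k : ℝ) * Real.pi)) • a τ = -a' τ := by
        rw [ha'_eq τ hτ, neg_apply]
        module
      rw [h_eq, inner_neg_right, norm_neg] at h
      linarith
    have h := intervalIntegral.integral_mono_on (μ := MeasureTheory.volume) hll
      (h_cont.neg.intervalIntegrable _ _)
      (hbc.intervalIntegrable _ _) h_le
    simp only [Pi.neg_apply] at h
    rw [intervalIntegral.integral_neg, ← h_int, h0] at h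
    simpa using h
  · intro hneg h0
    have hkabs : |(k : ℝ)| = -k := abs_of_neg (by exact_mod_cast hneg)
    have h_le : ∀ τ ∈ Set.Icc (-l) l,
        2 * inner ℝ (a τ) (a' τ) ≤ 1 / (|(k : ℝ)| * Real.pi) * ‖b τ‖ ^ 2 := by
      intro τ hτ
      have h := two_mul_inner_le_of_dissipative hc (hA1 τ hτ) (a τ) (b τ)
      have h_eq : b τ - A τ (a τ) - (2 * (|(k : ℝ)| * Real.pi)) • a τ = a' τ := by
        rw [ha'_eq τ hτ, hkabs]
        module
      rwa [h_eq] at h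
    have h := intervalIntegral.integral_mono_on (μ := MeasureTheory.volume) hll
      (h_cont.intervalIntegrable _ _)
      (hbc.intervalIntegrable _ _) h_le
    rw [← h_int, h0] at h
    simpa using h
end

section
/- Let p > 1, let 0 < δ < p − 1, let l > 0 and ε > 0, and set S(ε) = (1/(2π))·ln(1 + l/ε) and τ(ε) = l/ε + ((p−1)/δ)·S(ε). Then for every real τ with 0 ≤ τ ≤ l/ε, the exponential weight dominates the power weight: e^{2πδ(τ(ε) − τ)} ≥ l^{p−1−δ} · ε^{1−p+δ} · (1 + τ)^δ. -/
/-- On `0 ≤ τ ≤ l/ε` the exponential weight dominates the power weight: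
`e^{2πδ(τ(ε) - τ)} ≥ l^{p-1-δ} ε^{1-p+δ} (1+τ)^δ`, where
`S(ε) = (1/2π) log(1 + l/ε)` and `τ(ε) = l/ε + ((p-1)/δ) S(ε)`, for `0 < δ < p - 1`. -/
theorem exponential_weight_dominates_power_weight
    (p δ l ε : ℝ) (hp : 1 < p) (hδ0 : 0 < δ) (hδ : δ < p - 1)
    (hl : 0 < l) (hε : 0 < ε) (τ : ℝ) (hτ0 : 0 ≤ τ) (hτ : τ ≤ l / ε) :
    l ^ (p - 1 - δ) * ε ^ (1 - p + δ) * (1 + τ) ^ δ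
      ≤ Real.exp (2 * Real.pi * δ *
          ((l / ε + ((p - 1) / δ) * ((1 / (2 * Real.pi)) * Real.log (1 + l / ε))) - τ)) := by
  have hx : 0 < l / ε := div_pos hl hε
  have hscale : l ^ (p - 1 - δ) * ε ^ (1 - p + δ) = (l / ε) ^ (p - 1 - δ) := by
    rw [Real.div_rpow hl.le hε.le, show 1 - p + δ = -(p - 1 - δ) by ring,
      Real.rpow_neg hε.le, div_eq_mul_inv]
  have hexp : 2 * Real.pi * δ *
      ((l / ε + ((p - 1) / δ) * ((1 / (2 * Real.pi)) * Real.log (1 + l / ε))) - τ)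
        = 2 * Real.pi * δ * (l / ε - τ) + Real.log (1 + l / ε) * (p - 1) := by
    have hpi := Real.pi_ne_zero
    have hδ_ne := hδ0.ne'
    generalize l / ε = x
    field_simp
    ring
  calc l ^ (p - 1 - δ) * ε ^ (1 - p + δ) * (1 + τ) ^ δ
      = (l / ε) ^ (p - 1 - δ) * (1 + τ) ^ δ := by rw [hscale]
    _ ≤ (1 + l / ε) ^ (p - 1 - δ) * (1 + l / ε) ^ δ := by
        gcongr <;> linarith
    _ = Real.exp (Real.log (1 + l / ε) * (p - 1)) := by
        rw [← Real.rpow_add (by positivity), sub_add_cancel,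
          Real.rpow_def_of_pos (by positivity)]
    _ ≤ _ := by
        rw [hexp]
        have hgap : 0 ≤ 2 * Real.pi * δ * (l / ε - τ) :=
          mul_nonneg (by positivity) (sub_nonneg.mpr hτ)
        exact Real.exp_le_exp.mpr (by linarith)
end

section
/- Let p > 1, let δ > 0, let l > 0 and 0 < ε ≤ 1, and set S(ε) = (1/(2π))·ln(1 + l/ε) and τ(ε) = l/ε + ((p−1)/δ)·S(ε). Then for every real τ with τ ≥ l/ε, the exponential weight is dominated by the power weight: e^{2πδ(τ(ε) − τ)} ≤ (1 + l)^{p−1} · ε^{1−p} · (1 + τ)^δ. -/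
/-- On `τ ≥ l/ε` the exponential weight is dominated by the power weight:
`e^{2πδ(τ(ε) - τ)} ≤ (1+l)^{p-1} ε^{1-p} (1+τ)^δ`, where
`S(ε) = (1/2π) log(1 + l/ε)` and `τ(ε) = l/ε + ((p-1)/δ) S(ε)`. -/
theorem exponential_weight_dominated_by_power_weight
    (p δ l ε : ℝ) (hp : 1 < p) (hδ : 0 < δ) (hl : 0 < l)
    (hε0 : 0 < ε) (hε1 : ε ≤ 1) (τ : ℝ) (hτ : l / ε ≤ τ) :
    Real.exp (2 * Real.pi * δ *
        ((l / ε + ((p - 1) / δ) * ((1 / (2 * Real.pi)) * Real.log (1 + l / ε))) - τ))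
      ≤ (1 + l) ^ (p - 1) * ε ^ (1 - p) * (1 + τ) ^ δ := by
  have hpi : 0 < Real.pi := Real.pi_pos
  have hlε : 0 < l / ε := div_pos hl hε0
  have hexponent : 2 * Real.pi * δ *
        ((l / ε + ((p - 1) / δ) * ((1 / (2 * Real.pi)) * Real.log (1 + l / ε))) - τ)
      = Real.log (1 + l / ε) * (p - 1) - 2 * Real.pi * δ * (τ - l / ε) := by
    field_simp
    ring
  have hdecay : 0 ≤ 2 * Real.pi * δ * (τ - l / ε) :=
    mul_nonneg (by positivity) (sub_nonneg.2 hτ)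
  have hbase : 1 + l / ε ≤ (1 + l) / ε := by
    rw [add_div]
    gcongr
    exact (one_le_div hε0).2 hε1
  calc _ ≤ Real.exp (Real.log (1 + l / ε) * (p - 1)) := by
        rw [hexponent]
        exact Real.exp_le_exp.2 (sub_le_self _ hdecay)
    _ = (1 + l / ε) ^ (p - 1) := (Real.rpow_def_of_pos (by positivity) _).symm
    _ ≤ ((1 + l) / ε) ^ (p - 1) :=
        Real.rpow_le_rpow (by positivity) hbase (by linarith)
    _ = (1 + l) ^ (p - 1) * ε ^ (1 - p) := by
        rw [Real.div_rpow (by positivity) hε0.le, div_eq_mul_inv, ← Real.rpow_neg hε0.le,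
          neg_sub]
    _ ≤ (1 + l) ^ (p - 1) * ε ^ (1 - p) * (1 + τ) ^ δ :=
        le_mul_of_one_le_right (by positivity)
          (Real.one_le_rpow (by linarith) hδ.le)
end

section
/- Let n ≥ 1, let A₊, A₋ ∈ ℂⁿ, let α > 0, l > 0, ε > 0, and K ≥ 0. Let G : ℂⁿ → ℂⁿ be a map and χ : ℝ → ℂⁿ a differentiable curve satisfying χ′(s) = G(χ(s)) for all s, and assume ‖G(χ(s))‖ ≤ K for all s. Define u_ε : ℝ × ℝ → ℂⁿ by u_ε(τ, t) = ε^α · e^{−2πl/ε} · (A₊·e^{2π(τ + it)} + A₋·e^{−2π(τ + it)}) + χ(ετ). Then the Dirichlet energy of u_ε over the neck region satisfies ∫_{−l/ε}^{l/ε} ∫_0^1 ( ‖∂u_ε/∂τ(τ,t)‖² + ‖∂u_ε/∂t(τ,t)‖² ) dt dτ ≤ 6π·(‖A₊‖ + ‖A₋‖)²·ε^{2α} + 4·l·K²·ε. In particular the energy over the neck tends to 0 as ε → 0. -/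
/-- The derivative of `z ↦ e^{2πz} A + e^{-2πz} B` along a real curve in `ℂ`. -/
theorem hasDerivAt_exp_smul_add_exp_neg_smul {E : Type*} [NormedAddCommGroup E]
    [NormedSpace ℂ E] (A B : E) {z : ℝ → ℂ} {z' : ℂ} {x : ℝ} (hz : HasDerivAt z z' x) :
    HasDerivAt (fun s => Complex.exp (2 * (Real.pi : ℂ) * z s) • A
        + Complex.exp (-(2 * (Real.pi : ℂ) * z s)) • B)
      ((2 * (Real.pi : ℂ) * z') • (Complex.exp (2 * (Real.pi : ℂ) * z x) • A
        - Complex.exp (-(2 * (Real.pi : ℂ) * z x)) • B)) x := by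
  have h := hz.const_mul (2 * (Real.pi : ℂ))
  refine ((h.cexp.smul_const A).fun_add (h.fun_neg.cexp.smul_const B)).congr_deriv ?_
  module

theorem norm_exp_smul_sub_exp_neg_smul_sq_le {E : Type*} [NormedAddCommGroup E]
    [NormedSpace ℂ E] (A B : E) (τ t : ℝ) :
    ‖Complex.exp (2 * (Real.pi : ℂ) * ((τ : ℂ) + (t : ℂ) * Complex.I)) • A
        - Complex.exp (-(2 * (Real.pi : ℂ) * ((τ : ℂ) + (t : ℂ) * Complex.I))) • B‖ ^ 2
      ≤ (‖A‖ + ‖B‖) ^ 2 * (Real.exp (4 * Real.pi * τ) + Real.exp (-(4 * Real.pi * τ))) := by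
  have h := norm_sub_le (Complex.exp (2 * (Real.pi : ℂ) * ((τ : ℂ) + (t : ℂ) * Complex.I)) • A)
    (Complex.exp (-(2 * (Real.pi : ℂ) * ((τ : ℂ) + (t : ℂ) * Complex.I))) • B)
  have hre : (2 * (Real.pi : ℂ) * ((τ : ℂ) + (t : ℂ) * Complex.I)).re = 2 * Real.pi * τ := by
    simp
  rw [norm_smul, norm_smul, Complex.norm_exp, Complex.norm_exp, Complex.neg_re, hre] at h
  have hp : Real.exp (4 * Real.pi * τ) = Real.exp (2 * Real.pi * τ) ^ 2 := by
    rw [← Real.exp_nat_mul]; push_cast; ring_nf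
  have hm : Real.exp (-(4 * Real.pi * τ)) = Real.exp (-(2 * Real.pi * τ)) ^ 2 := by
    rw [← Real.exp_nat_mul]; push_cast; ring_nf
  rw [hp, hm]
  set p := Real.exp (2 * Real.pi * τ)
  set q := Real.exp (-(2 * Real.pi * τ))
  have hAB : 0 ≤ ‖A‖ * ‖B‖ * (p ^ 2 + q ^ 2) := by positivity
  calc _ ≤ (p * ‖A‖ + q * ‖B‖) ^ 2 := by gcongr
    _ ≤ (‖A‖ + ‖B‖) ^ 2 * (p ^ 2 + q ^ 2) := by
      nlinarith [sq_nonneg (p * ‖B‖ - q * ‖A‖)]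

theorem integral_exp_mul_add_exp_neg_mul {k : ℝ} (hk : k ≠ 0) (L : ℝ) :
    ∫ τ in (-L)..L, (Real.exp (k * τ) + Real.exp (-(k * τ)))
      = 2 * (Real.exp (k * L) - Real.exp (-(k * L))) / k := by
  have h (x : ℝ) : HasDerivAt (fun τ => (Real.exp (k * τ) - Real.exp (-(k * τ))) / k)
      (Real.exp (k * x) + Real.exp (-(k * x))) x := by
    have h1 : HasDerivAt (fun τ => k * τ) k x := by simpa using (hasDerivAt_id x).const_mul k
    refine ((h1.exp.fun_sub h1.fun_neg.exp).div_const k).congr_deriv ?_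
    field_simp
    ring
  rw [intervalIntegral.integral_eq_sub_of_hasDerivAt (fun x _ => h x)
    (Continuous.intervalIntegrable (by fun_prop) _ _)]
  simp only [mul_neg, neg_neg]
  ring


/-- Energy estimate over the neck region for the explicit approximate solution
`u_ε(τ,t) = ε^α e^{-2πl/ε} (A₊ e^{2π(τ+it)} + A₋ e^{-2π(τ+it)}) + χ(ετ)` with
`χ' = G ∘ χ` and `‖G(χ(s))‖ ≤ K`:
`∫_{-l/ε}^{l/ε} ∫_0^1 (‖∂u_ε/∂τ‖² + ‖∂u_ε/∂t‖²) dt dτ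
  ≤ 6π (‖A₊‖ + ‖A₋‖)² ε^{2α} + 4 l K² ε`. -/
theorem approximate_solution_neck_energy_bound
    (n : ℕ) (hn : 1 ≤ n) (Ap Am : EuclideanSpace ℂ (Fin n))
    (α l ε K : ℝ) (hα : 0 < α) (hl : 0 < l) (hε : 0 < ε) (hK : 0 ≤ K)
    (G : EuclideanSpace ℂ (Fin n) → EuclideanSpace ℂ (Fin n))
    (χ : ℝ → EuclideanSpace ℂ (Fin n)) (hχ : ∀ s, HasDerivAt χ (G (χ s)) s)
    (hGbound : ∀ s : ℝ, ‖G (χ s)‖ ≤ K)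
    (u : ℝ → ℝ → EuclideanSpace ℂ (Fin n))
    (hu : ∀ τ t : ℝ, u τ t
      = (ε ^ α * Real.exp (-(2 * Real.pi * l / ε))) •
          (Complex.exp (2 * (Real.pi : ℂ) * ((τ : ℂ) + (t : ℂ) * Complex.I)) • Ap
            + Complex.exp (-(2 * (Real.pi : ℂ) * ((τ : ℂ) + (t : ℂ) * Complex.I))) • Am)
        + χ (ε * τ)) :
    (∫ τ in (-(l / ε))..(l / ε), ∫ t in (0 : ℝ)..1,
        (‖deriv (fun σ => u σ t) τ‖ ^ 2 + ‖deriv (fun s => u τ s) t‖ ^ 2))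
      ≤ 6 * Real.pi * (‖Ap‖ + ‖Am‖) ^ 2 * ε ^ (2 * α) + 4 * l * K ^ 2 * ε := by
  set c : ℝ := ε ^ α * Real.exp (-(2 * Real.pi * l / ε)) with hc
  have hbound (τ t : ℝ) : ‖deriv (fun σ => u σ t) τ‖ ^ 2 + ‖deriv (fun s => u τ s) t‖ ^ 2
      ≤ 12 * Real.pi ^ 2 * c ^ 2 * (‖Ap‖ + ‖Am‖) ^ 2
          * (Real.exp (4 * Real.pi * τ) + Real.exp (-(4 * Real.pi * τ)))
        + 2 * ε ^ 2 * K ^ 2 := by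
    have hW := norm_exp_smul_sub_exp_neg_smul_sq_le Ap Am τ t
    have hτ : HasDerivAt (fun σ : ℝ => (σ : ℂ) + (t : ℂ) * Complex.I) 1 τ :=
      (Complex.ofRealCLM.hasDerivAt (x := τ)).add_const _
    have ht : HasDerivAt (fun s : ℝ => (τ : ℂ) + (s : ℂ) * Complex.I) Complex.I t := by
      simpa using ((Complex.ofRealCLM.hasDerivAt (x := t)).mul_const Complex.I).const_add (τ : ℂ)
    have hχτ : HasDerivAt (fun σ => χ (ε * σ)) (ε • G (χ (ε * τ))) τ :=
      (hχ (ε * τ)).scomp τ (by simpa using (hasDerivAt_id τ).const_mul ε)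
    have h1 := ((hasDerivAt_exp_smul_add_exp_neg_smul Ap Am hτ).const_smul c).add hχτ
    have h2 := ((hasDerivAt_exp_smul_add_exp_neg_smul Ap Am ht).const_smul c).add_const
      (χ (ε * τ))
    have e1 := (h1.congr_of_eventuallyEq (f₁ := fun σ => u σ t) (.of_forall fun σ => hu σ t)).deriv
    have e2 := (h2.congr_of_eventuallyEq (f₁ := fun s => u τ s) (.of_forall fun s => hu τ s)).deriv
    rw [e1, e2]
    set w := Complex.exp (2 * (Real.pi : ℂ) * ((τ : ℂ) + (t : ℂ) * Complex.I)) • Ap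
        - Complex.exp (-(2 * (Real.pi : ℂ) * ((τ : ℂ) + (t : ℂ) * Complex.I))) • Am
    have hc0 : 0 ≤ c := by positivity
    have n1 : ‖c • (2 * (Real.pi : ℂ) * 1) • w + ε • G (χ (ε * τ))‖
        ≤ 2 * Real.pi * c * ‖w‖ + ε * K := by
      refine (norm_add_le _ _).trans (add_le_add (le_of_eq ?_) ?_)
      · simp [norm_smul, abs_of_nonneg hc0, abs_of_pos Real.pi_pos]
        ring
      · rw [norm_smul, Real.norm_of_nonneg hε.le]
        gcongr
        exact hGbound _
    have n2 : ‖c • (2 * (Real.pi : ℂ) * Complex.I) • w‖ = 2 * Real.pi * c * ‖w‖ := by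
      simp [norm_smul, abs_of_nonneg hc0, abs_of_pos Real.pi_pos]
      ring
    rw [n2]
    calc _ ≤ (2 * Real.pi * c * ‖w‖ + ε * K) ^ 2 + (2 * Real.pi * c * ‖w‖) ^ 2 := by gcongr
      _ ≤ 12 * Real.pi ^ 2 * c ^ 2 * ‖w‖ ^ 2 + 2 * ε ^ 2 * K ^ 2 := by
        nlinarith [sq_nonneg (2 * Real.pi * c * ‖w‖ - ε * K)]
      _ ≤ 12 * Real.pi ^ 2 * c ^ 2 * ((‖Ap‖ + ‖Am‖) ^ 2
          * (Real.exp (4 * Real.pi * τ) + Real.exp (-(4 * Real.pi * τ)))) + 2 * ε ^ 2 * K ^ 2 := by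
        gcongr
      _ = _ := by ring
  have hL : -(l / ε) ≤ l / ε := by
    have : 0 < l / ε := by positivity
    linarith
  refine (Real.le_norm_self _).trans ((intervalIntegral.norm_integral_le_of_norm_le hL
    (g := fun τ => 12 * Real.pi ^ 2 * c ^ 2 * (‖Ap‖ + ‖Am‖) ^ 2
          * (Real.exp (4 * Real.pi * τ) + Real.exp (-(4 * Real.pi * τ))) + 2 * ε ^ 2 * K ^ 2)
    (.of_forall fun τ _ => ?_) (Continuous.intervalIntegrable (by fun_prop) _ _)).trans ?_)
  · refine (intervalIntegral.norm_integral_le_of_norm_le_const fun t _ => ?_).trans_eq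
      (by rw [sub_zero, abs_one, mul_one])
    rw [Real.norm_of_nonneg (by positivity)]
    exact hbound τ t
  · rw [intervalIntegral.integral_add (Continuous.intervalIntegrable (by fun_prop) _ _)
      (Continuous.intervalIntegrable (by fun_prop) _ _), intervalIntegral.integral_const_mul,
      integral_exp_mul_add_exp_neg_mul (by positivity), intervalIntegral.integral_const,
      smul_eq_mul]
    have hc2 : c ^ 2 * Real.exp (4 * Real.pi * (l / ε)) = ε ^ (2 * α) := by
      rw [hc, mul_pow, ← Real.rpow_mul_natCast hε.le, ← Real.exp_nat_mul, mul_assoc,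
        ← Real.exp_add]
      ring_nf
      simp
    have hneg : 0 ≤ 6 * Real.pi * (‖Ap‖ + ‖Am‖) ^ 2
        * (c ^ 2 * Real.exp (-(4 * Real.pi * (l / ε)))) := by positivity
    have hχint : (l / ε - -(l / ε)) * (2 * ε ^ 2 * K ^ 2) = 4 * l * K ^ 2 * ε := by
      field_simp
      ring
    have hmain : 12 * Real.pi ^ 2 * c ^ 2 * (‖Ap‖ + ‖Am‖) ^ 2
        * (2 * (Real.exp (4 * Real.pi * (l / ε)) - Real.exp (-(4 * Real.pi * (l / ε))))
          / (4 * Real.pi))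
        = 6 * Real.pi * (‖Ap‖ + ‖Am‖) ^ 2 * (c ^ 2 * Real.exp (4 * Real.pi * (l / ε)))
          - 6 * Real.pi * (‖Ap‖ + ‖Am‖) ^ 2
            * (c ^ 2 * Real.exp (-(4 * Real.pi * (l / ε)))) := by
      field_simp
      ring
    rw [hχint, hmain, hc2]
    linarith
end
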